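/- Weak disjunction property: if □(A ∨ B) is derivable in the natural deduction system IEL⁻ with no open hypotheses, then □A is derivable with no open hypotheses or □B is derivable with no open hypotheses. -/

import Mathlib

/-- Formulas of intuitionistic epistemic logic. -/
inductive Formula : Type
  | atom : ℕ → Formula
  | bot : Formula
  | top : Formula
  | and : Formula → Formula → Formula
  | or : Formula → Formula → Formula
  | impl : Formula → Formula → Formula
  | box : Formula → Formula
  deriving DecidableEq

namespace Formula

/-- Negation is defined: ¬A := A → ⊥. -/
def neg (A : Formula) : Formula := A.impl .bot

end Formula

/-- The natural deduction system IEL⁻: the propositional fragment of NJ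
extended by the □-introduction rule. -/
inductive ND : Set Formula → Formula → Prop
  | hyp {Γ : Set Formula} {A : Formula} : A ∈ Γ → ND Γ A
  | top_intro {Γ : Set Formula} : ND Γ Formula.top
  | bot_elim {Γ : Set Formula} {A : Formula} : ND Γ Formula.bot → ND Γ A
  | and_intro {Γ : Set Formula} {A B : Formula} : ND Γ A → ND Γ B → ND Γ (A.and B)
  | and_elim_left {Γ : Set Formula} {A B : Formula} : ND Γ (A.and B) → ND Γ A
  | and_elim_right {Γ : Set Formula} {A B : Formula} : ND Γ (A.and B) → ND Γ B
  | impl_intro {Γ : Set Formula} {A B : Formula} : ND (insert A Γ) B → ND Γ (A.impl B)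
  | impl_elim {Γ : Set Formula} {A B : Formula} : ND Γ (A.impl B) → ND Γ A → ND Γ B
  | or_intro_left {Γ : Set Formula} {A B : Formula} : ND Γ A → ND Γ (A.or B)
  | or_intro_right {Γ : Set Formula} {A B : Formula} : ND Γ B → ND Γ (A.or B)
  | or_elim {Γ : Set Formula} {A B C : Formula} :
      ND Γ (A.or B) → ND (insert A Γ) C → ND (insert B Γ) C → ND Γ C
  | box_intro {ps : List (Set Formula × Formula)} {Δ : Set Formula} {B : Formula} :
      (∀ p ∈ ps, ND p.1 (Formula.box p.2)) →
      ND ({A | ∃ p ∈ ps, p.2 = A} ∪ Δ) B →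
      ND ((⋃ p ∈ ps, p.1) ∪ Δ) (Formula.box B)

namespace ND

theorem weaken {Γ : Set Formula} {A : Formula} (h : ND Γ A) :
    ∀ {Δ : Set Formula}, Γ ⊆ Δ → ND Δ A := by
  induction h with
  | hyp h => exact fun hs => .hyp (hs h)
  | top_intro => exact fun _ => .top_intro
  | bot_elim _ ih => exact fun hs => .bot_elim (ih hs)
  | and_intro _ _ iha ihb => exact fun hs => .and_intro (iha hs) (ihb hs)
  | and_elim_left _ ih => exact fun hs => .and_elim_left (ih hs)
  | and_elim_right _ ih => exact fun hs => .and_elim_right (ih hs)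
  | impl_intro _ ih => exact fun hs => .impl_intro (ih (Set.insert_subset_insert hs))
  | impl_elim _ _ ih iha => exact fun hs => .impl_elim (ih hs) (iha hs)
  | or_intro_left _ ih => exact fun hs => .or_intro_left (ih hs)
  | or_intro_right _ ih => exact fun hs => .or_intro_right (ih hs)
  | or_elim _ _ _ ih iha ihb =>
    exact fun hs => .or_elim (ih hs) (iha (Set.insert_subset_insert hs))
      (ihb (Set.insert_subset_insert hs))
  | @box_intro ps Γ B hps _ _ ih =>
    intro Δ hs
    obtain ⟨hp, hΓ⟩ := Set.union_subset_iff.1 hs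
    have hbox := box_intro hps (ih (Set.union_subset_union_right _ hΓ))
    rwa [Set.union_eq_self_of_subset_left hp] at hbox

/-- Necessitation under hypotheses; this includes co-reflection `A ⊢ □A`. -/
theorem nec {Γ : Set Formula} {A : Formula} (h : ND Γ A) : ND Γ A.box := by
  have hbox := box_intro (ps := []) (Δ := Γ) (B := A) (by simp) (h.weaken (by simp))
  simpa using hbox

/-- The box rule with a single context shared by all premises. -/
theorem box_intro_shared {l : List (Set Formula × Formula)} {Γ : Set Formula} {B : Formula}
    (hl : ∀ p ∈ l, ND Γ p.2.box) (h : ND ({A | ∃ p ∈ l, p.2 = A} ∪ Γ) B) : ND Γ B.box := by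
  have hbox := box_intro (ps := l.map fun p => (Γ, p.2)) (Δ := Γ) (B := B)
    (List.forall_mem_map.2 hl) (h.weaken (by simp))
  exact hbox.weaken <| Set.union_subset
    (Set.iUnion₂_subset (List.forall_mem_map.2 fun _ _ => subset_rfl)) subset_rfl

theorem subst_insert {Γ Δ : Set Formula} (h : ∀ A ∈ Γ, ND Δ A) (B : Formula) :
    ∀ A ∈ insert B Γ, ND (insert B Δ) A := by
  rintro A (rfl | hA)
  · exact .hyp (Set.mem_insert _ _)
  · exact (h A hA).weaken (Set.subset_insert _ _)

/-- Simultaneous substitution of derivations for all hypotheses. -/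
theorem subst {Γ : Set Formula} {A : Formula} (h : ND Γ A) :
    ∀ {Δ : Set Formula}, (∀ B ∈ Γ, ND Δ B) → ND Δ A := by
  induction h with
  | hyp h => exact fun hs => hs _ h
  | top_intro => exact fun _ => .top_intro
  | bot_elim _ ih => exact fun hs => .bot_elim (ih hs)
  | and_intro _ _ iha ihb => exact fun hs => .and_intro (iha hs) (ihb hs)
  | and_elim_left _ ih => exact fun hs => .and_elim_left (ih hs)
  | and_elim_right _ ih => exact fun hs => .and_elim_right (ih hs)
  | impl_intro _ ih => exact fun hs => .impl_intro (ih (subst_insert hs _))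
  | impl_elim _ _ ih iha => exact fun hs => .impl_elim (ih hs) (iha hs)
  | or_intro_left _ ih => exact fun hs => .or_intro_left (ih hs)
  | or_intro_right _ ih => exact fun hs => .or_intro_right (ih hs)
  | or_elim _ _ _ ih iha ihb =>
    exact fun hs => .or_elim (ih hs) (iha (subst_insert hs _)) (ihb (subst_insert hs _))
  | box_intro _ _ ihps ih =>
    intro Δ hs
    refine box_intro_shared
      (fun p hp => ihps p hp fun C hC => hs C (.inl (Set.mem_biUnion hp hC))) (ih ?_)
    rintro C (hC | hC)
    · exact .hyp (.inl hC)
    · exact (hs C (.inr hC)).weaken Set.subset_union_right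

end ND

/-- The Kleene–Aczel slash, read through the box. -/
def Formula.Slash : Formula → Prop
  | .atom _ => False
  | .bot => False
  | .top => True
  | .and A B => A.Slash ∧ B.Slash
  | .or A B => A.Slash ∨ B.Slash
  | .impl A B => ND ∅ (A.impl B) ∧ (A.Slash → B.Slash)
  | .box A => A.Slash

theorem Formula.Slash.provable {A : Formula} (h : A.Slash) : ND ∅ A := by
  induction A with
  | atom => exact h.elim
  | bot => exact h.elim
  | top => exact .top_intro
  | and A B iha ihb => exact .and_intro (iha h.1) (ihb h.2)
  | or A B iha ihb =>
    exact h.elim (fun h => .or_intro_left (iha h)) (fun h => .or_intro_right (ihb h))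
  | impl A B => exact h.1
  | box A ih => exact .nec (ih h)

theorem ND.slash {Γ : Set Formula} {A : Formula} (h : ND Γ A) :
    (∀ B ∈ Γ, B.Slash) → A.Slash := by
  induction h with
  | hyp h => exact fun hs => hs _ h
  | top_intro => exact fun _ => trivial
  | bot_elim _ ih => exact fun hs => (ih hs).elim
  | and_intro _ _ iha ihb => exact fun hs => ⟨iha hs, ihb hs⟩
  | and_elim_left _ ih => exact fun hs => (ih hs).1
  | and_elim_right _ ih => exact fun hs => (ih hs).2
  | impl_intro h ih =>
    exact fun hs => ⟨(ND.impl_intro h).subst fun B hB => (hs B hB).provable,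
      fun ha => ih (Set.forall_mem_insert.2 ⟨ha, hs⟩)⟩
  | impl_elim _ _ ih iha => exact fun hs => (ih hs).2 (iha hs)
  | or_intro_left _ ih => exact fun hs => .inl (ih hs)
  | or_intro_right _ ih => exact fun hs => .inr (ih hs)
  | or_elim _ _ _ ih iha ihb =>
    exact fun hs => (ih hs).elim (fun ha => iha (Set.forall_mem_insert.2 ⟨ha, hs⟩))
      (fun hb => ihb (Set.forall_mem_insert.2 ⟨hb, hs⟩))
  | box_intro _ _ ihps ih =>
    intro hs
    refine ih ?_
    rintro C (⟨p, hp, rfl⟩ | hC)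
    · exact ihps p hp fun D hD => hs D (.inl (Set.mem_biUnion hp hD))
    · exact hs C (.inr hC)

/-- the weak disjunction property of IEL⁻. -/
theorem weak_disjunction_property (A B : Formula)
    (h : ND ∅ (Formula.box (A.or B))) :
    ND ∅ (Formula.box A) ∨ ND ∅ (Formula.box B) := by
  have hs : Formula.Slash (.box (A.or B)) := h.slash (by simp)
  exact hs.imp (fun ha => .nec ha.provable) (fun hb => .nec hb.provable)
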